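/- arXiv:2604.11588 — 2 statements merged into one kernel-verified Lean document; each statement's English description precedes it below -/
import Mathlib

section
/- Let G be a connected simple graph on {1, …, N} (N ≥ 2) with Laplacian L and second-smallest eigenvalue λ₂(L) > 0. Let f : ℝ^n → ℝ, μ > 0, and x* ∈ ℝ^n satisfy f(x) ≥ (μ/2)‖x − x*‖² for all x ∈ ℝ^n. Let ν ≥ 1 be an integer, let γ > 0, α_1, …, α_N > 0, and let x̄_1, …, x̄_N ∈ ℝ^n with network average x̄ = (1/N)∑_{i=1}^N x̄_i. Suppose the two bounds f(x̄) ≤ (1/(2ν)) (∑_{i=1}^N (1/α_i)) ‖x*‖² and (∑_{{i,j}∈E(G)} ‖x̄_i − x̄_j‖²)^{1/2} ≤ 2/(νγ) + (1/(2ν)) (∑_{i=1}^N (1/α_i)) ‖x*‖² hold. Then for every node i, ‖x̄_i − x*‖ ≤ (1/√(νμ)) (∑_{i=1}^N 1/α_i)^{1/2} ‖x*‖ + (1/√(ν λ₂(L))) (2/γ + (1/2)(∑_{i=1}^N (1/α_i)) ‖x*‖²). -/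
open Matrix

theorem aux_edge_sum {V : Type*} [Fintype V] [DecidableEq V] (G : SimpleGraph V)
    [DecidableRel G.Adj] (F : Sym2 V → ℝ) :
    ∑ i, ∑ j, (if G.Adj i j then F s(i, j) else 0) = 2 * ∑ e ∈ G.edgeFinset, F e := by
  have h1 : ∑ d : G.Dart, F d.edge = 2 * ∑ e ∈ G.edgeFinset, F e := by
    rw [← Finset.sum_fiberwise_of_maps_to (s := Finset.univ) (t := G.edgeFinset)
      (g := fun d : G.Dart => d.edge)
      (fun d _ => by rw [SimpleGraph.mem_edgeFinset]; exact d.edge_mem), Finset.mul_sum]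
    refine Finset.sum_congr rfl fun e he => ?_
    rw [Finset.sum_congr rfl (g := fun _ => F e)
      (fun d hd => by rw [(Finset.mem_filter.1 hd).2]), Finset.sum_const,
      G.dart_edge_fiber_card e (by simpa using he)]
    simp
  rw [← h1, ← Fintype.sum_prod_type' (f := fun i j => if G.Adj i j then F s(i, j) else 0),
    ← Finset.sum_filter]
  symm
  refine Finset.sum_bij' (fun d _ => (d.fst, d.snd))
    (fun xy h => ⟨xy, (Finset.mem_filter.1 h).2⟩) ?_ ?_ ?_ ?_ ?_ <;> simp
  intro a
  rfl

theorem aux_spectral {N : ℕ} (h1 : 1 < N) (G : SimpleGraph (Fin N)) [DecidableRel G.Adj]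
    (hconn : G.Connected) (hL : (G.lapMatrix ℝ).IsHermitian) (l : ℝ)
    (hl : l = (hL.eigenvalues ∘ Tuple.sort hL.eigenvalues) ⟨1, h1⟩) :
    0 < l ∧ ∀ y : Fin N → ℝ, ∑ i, y i = 0 →
      l * ∑ i, y i ^ 2 ≤ (∑ i, ∑ j, if G.Adj i j then (y i - y j) ^ 2 else 0) / 2 := by
  have hne : Nonempty (Fin N) := ⟨⟨0, by omega⟩⟩
  set e := hL.eigenvalues with he
  set b := hL.eigenvectorBasis with hb
  set σ := Tuple.sort e with hσ
  have hmono : Monotone (e ∘ σ) := Tuple.monotone_sort e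
  have hpos : ∀ i, 0 ≤ e i := fun i => (SimpleGraph.posSemidef_lapMatrix ℝ G).eigenvalues_nonneg i
  have hz : ∃ j, e j = 0 := by
    have h := hL.det_eq_prod_eigenvalues
    rw [SimpleGraph.det_lapMatrix_eq_zero] at h
    obtain ⟨j, -, hj⟩ := Finset.prod_eq_zero_iff.1 h.symm
    exact ⟨j, by simpa using hj⟩
  have h0 : e (σ ⟨0, by omega⟩) = 0 := by
    obtain ⟨j, hj⟩ := hz
    apply le_antisymm _ (hpos _)
    have := hmono (show (⟨0, by omega⟩ : Fin N) ≤ σ.symm j from Nat.zero_le _)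
    simpa [hj] using this
  have hconst : ∀ i, e i = 0 → ∃ c : ℝ, c ≠ 0 ∧ ∀ k, b i k = c := by
    intro i hi
    have h := hL.mulVec_eigenvectorBasis i
    rw [← he, hi, zero_smul, SimpleGraph.lapMatrix_mulVec_eq_zero_iff_forall_reachable] at h
    have hc : ∀ k, b i k = b i ⟨0, by omega⟩ := fun k => h _ _ (hconn.preconnected _ _)
    refine ⟨_, ?_, hc⟩
    intro hc0
    have : b i = 0 := by ext k; rw [hc k, hc0]; rfl
    exact b.toBasis.ne_zero i (by simpa using this)
  have hge : ∀ i, i ≠ σ ⟨0, by omega⟩ → l ≤ e i := by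
    intro i hi
    have hs : (⟨1, h1⟩ : Fin N) ≤ σ.symm i := by
      have : σ.symm i ≠ ⟨0, by omega⟩ := fun h => hi (by rw [← h]; simp)
      rw [Fin.le_def]
      rw [Ne, Fin.ext_iff] at this
      simp only at this ⊢
      omega
    have := hmono hs
    rw [hl]
    simpa using this
  have hin : ∀ (i : Fin N) (y : EuclideanSpace ℝ (Fin N)), inner ℝ (b i) y = ∑ k, y k * b i k := by
    intro i y
    simp [PiLp.inner_apply]
  refine ⟨?_, ?_⟩
  · rw [hl]
    refine lt_of_le_of_ne (hpos _) fun h => ?_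
    obtain ⟨c, hc, hc'⟩ := hconst _ h.symm
    obtain ⟨d, hd, hd'⟩ := hconst _ h0
    have horth := b.orthonormal.2 (i := σ ⟨1, h1⟩) (j := σ ⟨0, by omega⟩)
      (fun h => by have := σ.injective h; simp at this)
    beta_reduce at horth
    rw [hin] at horth
    simp only [hc', hd'] at horth
    simp [hc, hd] at horth
    omega
  · intro y hy
    let Y : EuclideanSpace ℝ (Fin N) := WithLp.toLp 2 y
    rw [← SimpleGraph.lapMatrix_toLinearMap₂', Matrix.toLinearMap₂'_apply']
    have hsq : ∑ i, y i ^ 2 = ∑ i, inner ℝ (b i) Y ^ 2 := by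
      rw [b.sum_sq_inner_right, EuclideanSpace.real_norm_sq_eq]
    have hq : y ⬝ᵥ G.lapMatrix ℝ *ᵥ y = ∑ i, e i * inner ℝ (b i) Y ^ 2 := by
      have h := b.sum_inner_mul_inner Y (WithLp.toLp 2 (G.lapMatrix ℝ *ᵥ y))
      have h2 : inner ℝ Y (WithLp.toLp 2 (G.lapMatrix ℝ *ᵥ y)) = y ⬝ᵥ G.lapMatrix ℝ *ᵥ y := by
        simp [PiLp.inner_apply, dotProduct, Y, mul_comm]
      rw [← h2, ← h]
      refine Finset.sum_congr rfl fun i _ => ?_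
      have h3 : inner ℝ (b i) (WithLp.toLp 2 (G.lapMatrix ℝ *ᵥ y)) = e i * inner ℝ (b i) Y := by
        have h4 : inner ℝ (b i) (WithLp.toLp 2 (G.lapMatrix ℝ *ᵥ y))
            = (⇑(b i)) ⬝ᵥ G.lapMatrix ℝ *ᵥ y := by
          simp [PiLp.inner_apply, dotProduct, mul_comm]
        have h5 := hL.mulVec_eigenvectorBasis i
        rw [h4, dotProduct_mulVec, ← mulVec_transpose, (G.isSymm_lapMatrix (R := ℝ)).eq, hb, h5, ← hb,
          smul_dotProduct, hin]
        simp [dotProduct, Y, mul_comm, he]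
      rw [h3, real_inner_comm]
      ring
    rw [hsq, hq, Finset.mul_sum]
    refine Finset.sum_le_sum fun i _ => ?_
    by_cases hi : i = σ ⟨0, by omega⟩
    · obtain ⟨d, hd, hd'⟩ := hconst i (hi ▸ h0)
      have : inner ℝ (b i) Y = 0 := by
        rw [hin]
        simp only [hd', ← Finset.sum_mul]
        simp [Y, hy]
      simp [this]
    · exact mul_le_mul_of_nonneg_right (hge i hi) (sq_nonneg _)

theorem aux_vec {N n : ℕ} (G : SimpleGraph (Fin N)) [DecidableRel G.Adj] (l : ℝ)
    (h : ∀ y : Fin N → ℝ, ∑ i, y i = 0 →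
      l * ∑ i, y i ^ 2 ≤ (∑ i, ∑ j, if G.Adj i j then (y i - y j) ^ 2 else 0) / 2)
    (z : Fin N → EuclideanSpace ℝ (Fin n)) (hz : ∑ i, z i = 0) :
    l * ∑ i, ‖z i‖ ^ 2 ≤ (∑ i, ∑ j, if G.Adj i j then ‖z i - z j‖ ^ 2 else 0) / 2 := by
  have hk := Finset.sum_le_sum (s := Finset.univ) fun (k : Fin n) _ => h (fun i => z i k) (by
    have := congrArg (fun v : EuclideanSpace ℝ (Fin n) => v k) hz
    simpa using this)
  rw [← Finset.mul_sum, ← Finset.sum_div, Finset.sum_comm] at hk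
  simp only [EuclideanSpace.real_norm_sq_eq]
  refine hk.trans (le_of_eq ?_)
  congr 1
  rw [Finset.sum_comm]
  refine Finset.sum_congr rfl fun i _ => ?_
  rw [Finset.sum_comm]
  refine Finset.sum_congr rfl fun j _ => ?_
  split_ifs <;> simp

/-- finite-communication error bound for the iteration-averaged
distributed estimates. Under μ-strong-convexity-type lower bound `f x ≥ (μ/2)‖x−x*‖²`,
the suboptimality bound `f x̄ ≤ (1/(2ν))(∑ 1/αᵢ)‖x*‖²` and the edge-disagreement bound
`(∑_{edges}‖x̄ᵢ−x̄ⱼ‖²)^{1/2} ≤ 2/(νγ) + (1/(2ν))(∑ 1/αᵢ)‖x*‖²`, every node satisfies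
`‖x̄ᵢ−x*‖ ≤ (1/√(νμ))(∑ 1/αᵢ)^{1/2}‖x*‖ + (1/√(νλ₂))(2/γ + (1/2)(∑ 1/αᵢ)‖x*‖²)`. -/
theorem distributed_admm_average_error_bound
    (N n : ℕ) (hN : 2 ≤ N)
    (G : SimpleGraph (Fin N)) [DecidableRel G.Adj]
    (hconn : G.Connected)
    (hL : (G.lapMatrix ℝ).IsHermitian)
    (lam₂ : ℝ)
    (hlam₂ : lam₂ = (hL.eigenvalues ∘ Tuple.sort hL.eigenvalues) ⟨1, by omega⟩)
    (f : EuclideanSpace ℝ (Fin n) → ℝ)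
    (μ : ℝ) (hμ : 0 < μ)
    (xstar : EuclideanSpace ℝ (Fin n))
    (hstrong : ∀ x, f x ≥ μ / 2 * ‖x - xstar‖ ^ 2)
    (ν : ℕ) (hν : 1 ≤ ν)
    (γ : ℝ) (hγ : 0 < γ)
    (α : Fin N → ℝ) (hα : ∀ i, 0 < α i)
    (xb : Fin N → EuclideanSpace ℝ (Fin n))
    (xbar : EuclideanSpace ℝ (Fin n))
    (hxbar : xbar = (N : ℝ)⁻¹ • ∑ i : Fin N, xb i)
    (hsubopt : f xbar ≤ 1 / (2 * ν) * (∑ i : Fin N, 1 / α i) * ‖xstar‖ ^ 2)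
    (hdisagree : Real.sqrt (∑ e ∈ G.edgeFinset,
        Sym2.lift ⟨fun i j => ‖xb i - xb j‖ ^ 2,
          fun i j => by simp only []; rw [norm_sub_rev]⟩ e) ≤
      2 / (ν * γ) + 1 / (2 * ν) * (∑ i : Fin N, 1 / α i) * ‖xstar‖ ^ 2) :
    ∀ i : Fin N, ‖xb i - xstar‖ ≤
      1 / Real.sqrt (ν * μ) * Real.sqrt (∑ i : Fin N, 1 / α i) * ‖xstar‖ +
        1 / Real.sqrt (ν * lam₂) *
          (2 / γ + 1 / 2 * (∑ i : Fin N, 1 / α i) * ‖xstar‖ ^ 2) := by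
  obtain ⟨hl, hP⟩ := aux_spectral (lt_of_lt_of_le one_lt_two hN) G hconn hL lam₂ hlam₂
  intro i
  have hNpos : (N : ℝ) ≠ 0 := by positivity
  have hν1 : (1 : ℝ) ≤ ν := by exact_mod_cast hν
  have hν0 : (0 : ℝ) < ν := by linarith
  have hS : 0 ≤ ∑ i : Fin N, 1 / α i := Finset.sum_nonneg fun i _ => by have := hα i; positivity
  set S := ∑ i : Fin N, 1 / α i with hSdef
  have hz : ∑ i, (xb i - xbar) = 0 := by
    rw [Finset.sum_sub_distrib, hxbar]
    simp [← Nat.cast_smul_eq_nsmul ℝ, smul_smul, hNpos]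
  have hV := aux_vec G lam₂ hP (fun i => xb i - xbar) hz
  have hE := aux_edge_sum G (Sym2.lift ⟨fun i j => ‖xb i - xb j‖ ^ 2,
          fun i j => by simp only []; rw [norm_sub_rev]⟩)
  simp only [Sym2.lift_mk] at hE
  simp only [sub_sub_sub_cancel_right] at hV
  rw [hE, mul_div_cancel_left₀ _ (two_ne_zero)] at hV
  set T := ∑ e ∈ G.edgeFinset, Sym2.lift ⟨fun i j => ‖xb i - xb j‖ ^ 2,
          fun i j => by simp only []; rw [norm_sub_rev]⟩ e with hT
  set K := 2 / γ + 1 / 2 * S * ‖xstar‖ ^ 2 with hK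
  have hK0 : 0 ≤ K := by positivity
  have hd : Real.sqrt T ≤ K / ν := by
    refine hdisagree.trans (le_of_eq ?_)
    rw [hK]
    field_simp
  have hi : ‖xb i - xbar‖ ^ 2 ≤ ∑ i, ‖xb i - xbar‖ ^ 2 :=
    Finset.single_le_sum (f := fun i => ‖xb i - xbar‖ ^ 2) (fun _ _ => sq_nonneg _)
      (Finset.mem_univ i)
  have hT' : Real.sqrt lam₂ * ‖xb i - xbar‖ ≤ K / ν := by
    refine le_trans ?_ hd
    apply Real.le_sqrt_of_sq_le
    rw [mul_pow, Real.sq_sqrt hl.le]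
    exact (mul_le_mul_of_nonneg_left hi hl.le).trans hV
  have hA : ‖xb i - xbar‖ ≤ 1 / Real.sqrt (ν * lam₂) * K := by
    rw [Real.sqrt_mul hν0.le]
    have hsl : 0 < Real.sqrt lam₂ := Real.sqrt_pos.2 hl
    have hsν : 1 ≤ Real.sqrt ν := Real.one_le_sqrt.2 hν1
    have hsν2 : Real.sqrt ν * Real.sqrt ν = ν := Real.mul_self_sqrt hν0.le
    have hle : K / ν ≤ K / Real.sqrt ν :=
      div_le_div_of_nonneg_left hK0 (by linarith) (by nlinarith)
    have h1 : ‖xb i - xbar‖ ≤ (K / Real.sqrt ν) / Real.sqrt lam₂ := by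
      rw [le_div_iff₀ hsl, mul_comm]
      exact hT'.trans hle
    refine h1.trans (le_of_eq ?_)
    rw [div_div, one_div_mul_eq_div]
  have hB : ‖xbar - xstar‖ ≤ 1 / Real.sqrt (ν * μ) * Real.sqrt S * ‖xstar‖ := by
    refine (sq_le_sq₀ (by positivity) (by positivity)).1 ?_
    rw [mul_pow, mul_pow, div_pow, Real.sq_sqrt (by positivity), Real.sq_sqrt hS]
    have h1 := (hstrong xbar).le.trans hsubopt
    have h2 : 1 ^ 2 / (ν * μ) * S * ‖xstar‖ ^ 2
        = (2 / μ) * (1 / (2 * ν) * S * ‖xstar‖ ^ 2) := by field_simp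
    rw [h2]
    calc ‖xbar - xstar‖ ^ 2 = (2 / μ) * (μ / 2 * ‖xbar - xstar‖ ^ 2) := by field_simp
      _ ≤ _ := mul_le_mul_of_nonneg_left h1 (by positivity)
  calc ‖xb i - xstar‖ = ‖(xbar - xstar) + (xb i - xbar)‖ := by congr 1; abel
    _ ≤ _ := (norm_add_le _ _).trans (add_le_add hB hA)
end

section
/- Let G be a connected simple graph on {1, …, N} (N ≥ 2) with Laplacian L and second-smallest eigenvalue λ₂(L) > 0, let f : ℝ^n → ℝ, μ > 0, x* ∈ ℝ^n with f(x) ≥ (μ/2)‖x − x*‖² for all x, and let γ > 0 and α_1, …, α_N > 0. For each integer ν ≥ 1, let x̄_1^{(ν)}, …, x̄_N^{(ν)} ∈ ℝ^n with average x̄^{(ν)}, and suppose that for every ν ≥ 1 the bounds f(x̄^{(ν)}) ≤ (1/(2ν)) (∑_{i=1}^N (1/α_i)) ‖x*‖² and (∑_{{i,j}∈E(G)} ‖x̄_i^{(ν)} − x̄_j^{(ν)}‖²)^{1/2} ≤ 2/(νγ) + (1/(2ν)) (∑_{i=1}^N (1/α_i)) ‖x*‖² hold. Then for every node i, ‖x̄_i^{(ν)}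 − x*‖ → 0 as ν → ∞; that is, the iteration-averaged estimates converge exactly to x* as the number of communication iterations per time step tends to infinity. -/
open Matrix Filter

/-- under the per-round suboptimality and edge-disagreement bounds
(valid for every number `ν ≥ 1` of communication iterations), the
iteration-averaged estimates of every node converge exactly to `x*` as `ν → ∞`. -/
theorem distributed_admm_exact_convergence_with_communication
    (N n : ℕ) (hN : 2 ≤ N)
    (G : SimpleGraph (Fin N)) [DecidableRel G.Adj]
    (hconn : G.Connected)
    (hL : (G.lapMatrix ℝ).IsHermitian)
    (lam₂ : ℝ)
    (hlam₂ : lam₂ = (hL.eigenvalues ∘ Tuple.sort hL.eigenvalues) ⟨1, by omega⟩)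
    (hlam₂pos : 0 < lam₂)
    (f : EuclideanSpace ℝ (Fin n) → ℝ)
    (μ : ℝ) (hμ : 0 < μ)
    (xstar : EuclideanSpace ℝ (Fin n))
    (hstrong : ∀ x, f x ≥ μ / 2 * ‖x - xstar‖ ^ 2)
    (γ : ℝ) (hγ : 0 < γ)
    (α : Fin N → ℝ) (hα : ∀ i, 0 < α i)
    (xb : ℕ → Fin N → EuclideanSpace ℝ (Fin n))
    (xbar : ℕ → EuclideanSpace ℝ (Fin n))
    (hxbar : ∀ ν, xbar ν = (N : ℝ)⁻¹ • ∑ i : Fin N, xb ν i)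
    (hsubopt : ∀ ν : ℕ, 1 ≤ ν →
      f (xbar ν) ≤ 1 / (2 * ν) * (∑ i : Fin N, 1 / α i) * ‖xstar‖ ^ 2)
    (hdisagree : ∀ ν : ℕ, 1 ≤ ν →
      Real.sqrt (∑ e ∈ G.edgeFinset,
          Sym2.lift ⟨fun i j => ‖xb ν i - xb ν j‖ ^ 2,
            fun i j => by simp only []; rw [norm_sub_rev]⟩ e) ≤
        2 / (ν * γ) + 1 / (2 * ν) * (∑ i : Fin N, 1 / α i) * ‖xstar‖ ^ 2) :
    ∀ i : Fin N, Tendsto (fun ν : ℕ => ‖xb ν i - xstar‖) atTop (nhds 0) := by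
  have h0 : Tendsto (fun ν : ℕ => ((ν : ℝ))⁻¹) atTop (nhds 0) := tendsto_inv_atTop_nhds_zero_nat
  have hadj : ∀ i j, G.Adj i j → Tendsto (fun ν => xb ν i - xb ν j) atTop (nhds 0) := by
    intro i j hij
    have hb : Tendsto (fun ν : ℕ => 2 / (ν * γ) + 1 / (2 * ν) * (∑ i : Fin N, 1 / α i) * ‖xstar‖ ^ 2)
        atTop (nhds 0) := by
      have := h0.mul_const (2 / γ + 1 / 2 * (∑ i : Fin N, 1 / α i) * ‖xstar‖ ^ 2)
      rw [zero_mul] at this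
      refine this.congr fun ν => ?_
      rw [div_eq_mul_inv 2 ((ν : ℝ) * γ), one_div (2 * (ν : ℝ)), mul_inv, mul_inv]
      ring
    refine squeeze_zero_norm' ?_ hb
    filter_upwards [eventually_ge_atTop 1] with ν hν
    refine le_trans ?_ (hdisagree ν hν)
    apply Real.le_sqrt_of_sq_le
    have hmem : s(i, j) ∈ G.edgeFinset := by simpa using hij
    refine le_trans (le_of_eq ?_) (Finset.single_le_sum (fun e _ => ?_) hmem)
    · rfl
    · induction e using Sym2.ind with
      | _ a b => exact sq_nonneg _
  have hall : ∀ i j, Tendsto (fun ν => xb ν i - xb ν j) atTop (nhds 0) := by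
    intro i j
    obtain ⟨w⟩ := hconn.preconnected i j
    induction w with
    | nil => simp
    | cons h _ ih =>
      have := (hadj _ _ h).add ih
      simpa using this
  have hbar : Tendsto (fun ν => xbar ν - xstar) atTop (nhds 0) := by
    have hb : Tendsto (fun ν : ℕ => Real.sqrt
        (2 / μ * (1 / (2 * ν) * (∑ i : Fin N, 1 / α i) * ‖xstar‖ ^ 2))) atTop (nhds 0) := by
      have := (h0.mul_const (2 / μ * (1 / 2 * (∑ i : Fin N, 1 / α i) * ‖xstar‖ ^ 2))).sqrt
      rw [zero_mul, Real.sqrt_zero] at this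
      refine this.congr fun ν => ?_
      rw [one_div (2 * (ν : ℝ)), mul_inv]
      congr 1
      ring
    refine squeeze_zero_norm' ?_ hb
    filter_upwards [eventually_ge_atTop 1] with ν hν
    apply Real.le_sqrt_of_sq_le
    have h1 := (hstrong (xbar ν)).le.trans (hsubopt ν hν)
    calc ‖xbar ν - xstar‖ ^ 2 = 2 / μ * (μ / 2 * ‖xbar ν - xstar‖ ^ 2) := by field_simp
      _ ≤ _ := mul_le_mul_of_nonneg_left h1 (by positivity)
  intro i
  have hs : Tendsto (fun ν => (N : ℝ)⁻¹ • ∑ j : Fin N, (xb ν i - xb ν j)) atTop (nhds 0) := by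
    have := (tendsto_finsetSum Finset.univ fun j _ => hall i j).const_smul ((N : ℝ)⁻¹)
    simpa using this
  have ht := (hs.add hbar).norm
  rw [add_zero, norm_zero] at ht
  refine ht.congr fun ν => ?_
  have hN0 : (N : ℝ) ≠ 0 := by
    have : N ≠ 0 := by omega
    exact_mod_cast this
  have key : (N : ℝ)⁻¹ • ∑ j : Fin N, (xb ν i - xb ν j) = xb ν i - xbar ν := by
    rw [hxbar, Finset.sum_sub_distrib, smul_sub, Finset.sum_const, Finset.card_univ,
      Fintype.card_fin, ← Nat.cast_smul_eq_nsmul ℝ, smul_smul, inv_mul_cancel₀ hN0, one_smul]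
  rw [key, sub_add_sub_cancel]
end
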